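/- Let H be a graded, commutative, connected Hopf algebra over a field k of characteristic zero. Define, for an infinitesimal character α ∈ g(H), Q(α) = Σ_{n≥0} Q_n(α), where Q_0(α) = δ and Q_n(α) = Σ κ(j_1,…,j_k) · α_{j_1} * ⋯ * α_{j_k}, the sum over all compositions j_1+⋯+j_k = n with j_i > 0, α_j the restriction of α to H_j, and κ(j_1,…,j_k) = (j_1 j_2 ⋯ j_k)/(j_1(j_1+j_2)⋯(j_1+⋯+j_k)). Then Q is a bijection from g(H) onto the group of characters G(H), and its inverse is given by Q^{−1}(β) = β ∘ Y^{−1} ∘ D, right composition with the Dynkin idempotent, where D = S * Y is the Dynkin operator and Y^{−1} ∘ D acts on H_n as (1/n)D for n ≥ 1 and as 0 on H_0. -/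

import Mathlib

open TensorProduct

noncomputable section

/-- The convolution product on `End_k(H)`. -/
def convE {k H : Type} [Field k] [CommRing H] [Bialgebra k H]
    (f g : H →ₗ[k] H) : H →ₗ[k] H :=
  (LinearMap.mul' k H) ∘ₗ (TensorProduct.map f g) ∘ₗ (Coalgebra.comul (R := k))

/-- The convolution product on `k`-valued linear maps. -/
def convK {k H : Type} [Field k] [CommRing H] [Bialgebra k H]
    (f g : H →ₗ[k] k) : H →ₗ[k] k :=
  (LinearMap.mul' k k) ∘ₗ (TensorProduct.map f g) ∘ₗ (Coalgebra.comul (R := k))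

/-- Iterated convolution `f₁ * ⋯ * f_l` (empty convolution = `δ = ε`). -/
def convList {k H : Type} [Field k] [CommRing H] [Bialgebra k H]
    (l : List (H →ₗ[k] k)) : H →ₗ[k] k :=
  l.foldr convK (Coalgebra.counit (R := k))

/-- A character: a unital algebra morphism `H → k`. -/
def IsChar {k H : Type} [Field k] [CommRing H] [Bialgebra k H]
    (f : H →ₗ[k] k) : Prop :=
  f 1 = 1 ∧ ∀ x y : H, f (x * y) = f x * f y

/-- An infinitesimal character: `f(xy) = f(x)ε(y) + ε(x)f(y)`. -/
def IsInfChar {k H : Type} [Field k] [CommRing H] [Bialgebra k H]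
    (f : H →ₗ[k] k) : Prop :=
  ∀ x y : H, f (x * y) = f x * Coalgebra.counit (R := k) y
    + Coalgebra.counit (R := k) x * f y

/-- The projection of `H` onto its graded piece `ℋ j`. -/
def gradedProj {k H : Type} [Field k] [AddCommGroup H] [Module k H]
    (ℋ : ℕ → Submodule k H) [DirectSum.Decomposition ℋ] (j : ℕ) : H →ₗ[k] H :=
  (ℋ j).subtype ∘ₗ (DirectSum.component k ℕ (fun i => ↥(ℋ i)) j) ∘ₗ
    (DirectSum.decomposeLinearEquiv ℋ).toLinearMap

/-- The product of the partial sums `j₁(j₁+j₂)⋯(j₁+⋯+j_k)` of a list. -/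
def partialSumsProd (l : List ℕ) : ℕ :=
  ((List.range l.length).map (fun i => (l.take (i + 1)).sum)).prod

/-- The coefficient `κ(j₁,…,j_k) = (j₁j₂⋯j_k)/(j₁(j₁+j₂)⋯(j₁+⋯+j_k))`, as an element
of `k`. -/
def kappa (k : Type) [Field k] (l : List ℕ) : k :=
  ((l.map (fun j => (j : k))).prod) * ((partialSumsProd l : k))⁻¹

/-- The value on the graded piece `ℋ n` of `Q(α) = ∑_n Q_n(α)`, where
`Q_n(α) = ∑ κ(j₁,…,j_k) · α_{j₁} * ⋯ * α_{j_k}`, the sum being over all compositions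
`j₁+⋯+j_k = n`. -/
def QFormula {k H : Type} [Field k] [CommRing H] [Bialgebra k H]
    (ℋ : ℕ → Submodule k H) [DirectSum.Decomposition ℋ]
    (α : H →ₗ[k] k) (n : ℕ) (x : H) : k :=
  ∑ c : Composition n,
    kappa k c.blocks • convList (c.blocks.map (fun j => α ∘ₗ gradedProj ℋ j)) x

section Convolution

variable {k H : Type} [Field k] [CommRing H] [Bialgebra k H]

/-- The operator `(id ⊗ f) ∘ Δ` on `H`, whose transpose is right convolution by `f`. -/
def rightConv (f : H →ₗ[k] k) : H →ₗ[k] H :=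
  (TensorProduct.rid k H).toLinearMap ∘ₗ f.lTensor H ∘ₗ Coalgebra.comul

lemma convK_apply (f g : H →ₗ[k] k) (x : H) :
    convK f g x = LinearMap.mul' k k (TensorProduct.map f g (Coalgebra.comul (R := k) x)) := rfl

lemma convE_apply (f g : H →ₗ[k] H) (x : H) :
    convE f g x = LinearMap.mul' k H (TensorProduct.map f g (Coalgebra.comul (R := k) x)) := rfl

lemma rightConv_apply (f : H →ₗ[k] k) (x : H) :
    rightConv f x = TensorProduct.rid k H (f.lTensor H (Coalgebra.comul (R := k) x)) := rfl

lemma rightConv_counit (x : H) : rightConv (Coalgebra.counit (R := k)) x = x := by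
  simp [rightConv_apply]

lemma convK_eq_comp_rightConv (f g : H →ₗ[k] k) : convK f g = f ∘ₗ rightConv g := by
  ext x
  rw [LinearMap.comp_apply, convK_apply, rightConv_apply]
  generalize Coalgebra.comul (R := k) x = t
  induction t with
  | zero => simp
  | tmul a b => simp [mul_comm]
  | add a b ha hb => simp only [map_add, ha, hb]

lemma convK_assoc (f g h : H →ₗ[k] k) : convK (convK f g) h = convK f (convK g h) :=
  congrArg WithConv.ofConv (mul_assoc (WithConv.toConv f) (WithConv.toConv g) (WithConv.toConv h))

lemma counit_convK (f : H →ₗ[k] k) : convK (Coalgebra.counit (R := k)) f = f :=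
  congrArg WithConv.ofConv (one_mul (WithConv.toConv f))

lemma convK_counit (f : H →ₗ[k] k) : convK f (Coalgebra.counit (R := k)) = f :=
  congrArg WithConv.ofConv (mul_one (WithConv.toConv f))

lemma convList_append_singleton (l : List (H →ₗ[k] k)) (f : H →ₗ[k] k) :
    convList (l ++ [f]) = convK (convList l) f := by
  induction l with
  | nil => simp [convList, counit_convK, convK_counit]
  | cons g l ih =>
    change convK g (convList (l ++ [f])) = convK (convK g (convList l)) f
    rw [ih, convK_assoc]

/-- Composition with a character is multiplicative for convolution. -/
lemma IsChar.comp_convE {β : H →ₗ[k] k} (hβ : IsChar β) (f g : H →ₗ[k] H) :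
    β ∘ₗ convE f g = convK (β ∘ₗ f) (β ∘ₗ g) := by
  ext x
  rw [LinearMap.comp_apply, convK_apply, convE_apply]
  generalize Coalgebra.comul (R := k) x = t
  induction t with
  | zero => simp
  | tmul a b => simp [hβ.2]
  | add a b ha hb => simp only [map_add, ha, hb]

lemma IsInfChar.map_one {α : H →ₗ[k] k} (hα : IsInfChar α) : α 1 = 0 := by
  simpa using hα 1 1

/-- Right convolution by an infinitesimal character is a derivation. -/
lemma IsInfChar.rightConv_mul {α : H →ₗ[k] k} (hα : IsInfChar α) (x y : H) :
    rightConv α (x * y) = rightConv α x * y + x * rightConv α y := by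
  have key (s t : H ⊗[k] H) :
      TensorProduct.rid k H (α.lTensor H (s * t)) =
        TensorProduct.rid k H (α.lTensor H s) *
            TensorProduct.rid k H ((Coalgebra.counit (R := k)).lTensor H t) +
          TensorProduct.rid k H ((Coalgebra.counit (R := k)).lTensor H s) *
            TensorProduct.rid k H (α.lTensor H t) := by
    induction s with
    | zero => simp
    | add a b ha hb => simp only [add_mul, map_add, ha, hb]; ring
    | tmul a b =>
      induction t with
      | zero => simp
      | add c d hc hd => simp only [mul_add, map_add, hc, hd]; ring
      | tmul c d => simp [hα b d, add_smul, smul_smul, mul_comm]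
  have h := key (Coalgebra.comul (R := k) x) (Coalgebra.comul (R := k) y)
  rw [← Bialgebra.comul_mul] at h
  simpa [rightConv_apply] using h

end Convolution

section Dynkin

variable {k H : Type} [Field k] [CommRing H] [HopfAlgebra k H]

/-- The Dynkin operator `S * Y` of a derivation `Y` is an `ε`-derivation. -/
lemma convE_antipode_mul {Y : H →ₗ[k] H} (hY : ∀ x y, Y (x * y) = Y x * y + x * Y y) (x y : H) :
    convE (HopfAlgebra.antipode k) Y (x * y) =
      Coalgebra.counit (R := k) y • convE (HopfAlgebra.antipode k) Y x +
        Coalgebra.counit (R := k) x • convE (HopfAlgebra.antipode k) Y y := by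
  have key (s t : H ⊗[k] H) :
      LinearMap.mul' k H (TensorProduct.map (HopfAlgebra.antipode k) Y (s * t)) =
        LinearMap.mul' k H (TensorProduct.map (HopfAlgebra.antipode k) Y s) *
            LinearMap.mul' k H ((HopfAlgebra.antipode k).rTensor H t) +
          LinearMap.mul' k H ((HopfAlgebra.antipode k).rTensor H s) *
            LinearMap.mul' k H (TensorProduct.map (HopfAlgebra.antipode k) Y t) := by
    induction s with
    | zero => simp
    | add a b ha hb => simp only [add_mul, map_add, ha, hb]; ring
    | tmul a b =>
      induction t with
      | zero => simp
      | add c d hc hd => simp only [mul_add, map_add, hc, hd]; ring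
      | tmul c d =>
        simp only [Algebra.TensorProduct.tmul_mul_tmul, TensorProduct.map_tmul, hY,
          HopfAlgebra.antipode_mul_distrib, LinearMap.mul'_apply, LinearMap.rTensor_tmul]
        ring
  have h := key (Coalgebra.comul (R := k) x) (Coalgebra.comul (R := k) y)
  rw [← Bialgebra.comul_mul] at h
  simp only [HopfAlgebra.mul_antipode_rTensor_comul_apply] at h
  rw [convE_apply, h, convE_apply, convE_apply, Algebra.smul_def, Algebra.smul_def]
  ring

lemma IsChar.comp_antipode_convK {β : H →ₗ[k] k} (hβ : IsChar β) :
    convK (β ∘ₗ HopfAlgebra.antipode k) β = Coalgebra.counit (R := k) := by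
  have h := hβ.comp_convE (HopfAlgebra.antipode k) LinearMap.id
  rw [LinearMap.comp_id] at h
  rw [← h]
  ext x
  have := HopfAlgebra.mul_antipode_rTensor_comul_apply (R := k) x
  rw [LinearMap.rTensor] at this
  rw [LinearMap.comp_apply, convE_apply, this, Algebra.algebraMap_eq_smul_one, map_smul, hβ.1]
  simp

lemma IsChar.convK_comp_antipode {β : H →ₗ[k] k} (hβ : IsChar β) :
    convK β (β ∘ₗ HopfAlgebra.antipode k) = Coalgebra.counit (R := k) := by
  have h := hβ.comp_convE LinearMap.id (HopfAlgebra.antipode k)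
  rw [LinearMap.comp_id] at h
  rw [← h]
  ext x
  have := HopfAlgebra.mul_antipode_lTensor_comul_apply (R := k) x
  rw [LinearMap.lTensor] at this
  rw [LinearMap.comp_apply, convE_apply, this, Algebra.algebraMap_eq_smul_one, map_smul, hβ.1]
  simp

/-- `β ∘ D` is the logarithmic derivative `β⁻¹ * (β ∘ Y)`. -/
lemma IsChar.comp_dynkin_eq_iff {β : H →ₗ[k] k} (hβ : IsChar β) (Y : H →ₗ[k] H)
    (f : H →ₗ[k] k) :
    β ∘ₗ convE (HopfAlgebra.antipode k) Y = f ↔ β ∘ₗ Y = convK β f := by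
  rw [hβ.comp_convE]
  constructor
  · rintro rfl
    rw [← convK_assoc, hβ.convK_comp_antipode, counit_convK]
  · intro h
    rw [h, ← convK_assoc, hβ.comp_antipode_convK, counit_convK]

end Dynkin

section Compositions

lemma partialSumsProd_append_singleton (l : List ℕ) (j : ℕ) :
    partialSumsProd (l ++ [j]) = partialSumsProd l * (l.sum + j) := by
  simp only [partialSumsProd, List.length_append, List.length_singleton, List.range_succ,
    List.map_append, List.prod_append, List.map_singleton, List.prod_singleton]
  congr 1
  · congr 1
    refine List.map_congr_left fun i hi => ?_
    rw [List.take_append_of_le_length (by simpa using hi)]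
  · rw [List.take_of_length_le (by simp)]
    simp

lemma kappa_append_singleton (k : Type) [Field k] (l : List ℕ) (j : ℕ) :
    kappa k (l ++ [j]) = kappa k l * j * ((l.sum + j : ℕ) : k)⁻¹ := by
  simp [kappa, partialSumsProd_append_singleton]
  ring

/-- Sums over compositions of a positive integer, organized by the last part. -/
lemma Composition.sum_eq_sum_last {M : Type*} [AddCommMonoid M] {n : ℕ} (hn : 0 < n)
    (F : List ℕ → M) :
    ∑ c : Composition n, F c.blocks =
      ∑ j ∈ Finset.range n, ∑ c : Composition (n - 1 - j), F (c.blocks ++ [j + 1]) := by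
  rw [Finset.sum_sigma']
  symm
  refine Finset.sum_bij (fun p hp => ⟨p.2.blocks ++ [p.1 + 1], ?_, ?_⟩) ?_ ?_ ?_ ?_
  · intro i hi
    rcases List.mem_append.1 hi with hi | hi
    · exact p.2.blocks_pos hi
    · simp at hi; omega
  · have := Finset.mem_range.1 (Finset.mem_sigma.1 hp).1
    rw [List.sum_append, p.2.blocks_sum]
    simp
    omega
  · simp
  · rintro ⟨i, c⟩ hc ⟨j, d⟩ hd h
    obtain ⟨h1, h2⟩ := List.append_inj' (congrArg Composition.blocks h) rfl
    obtain rfl : i = j := by simpa using h2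
    exact congrArg (Sigma.mk i) (Composition.ext h1)
  · rintro c -
    rcases List.eq_nil_or_concat c.blocks with h | ⟨l, b, h⟩
    · have := c.blocks_sum
      simp [h] at this
      omega
    · have hs := c.blocks_sum
      have hb : 0 < b := c.blocks_pos (by simp [h])
      simp [h] at hs
      refine ⟨⟨b - 1, ⟨l, fun hi => c.blocks_pos (by simp [h, hi]), by omega⟩⟩, ?_, ?_⟩
      · simp; omega
      · ext1
        simp [h, Nat.sub_add_cancel hb]
  · simp

end Compositions

section Graded

variable {k H : Type} [Field k] [CommRing H] [Bialgebra k H]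
  {ℋ : ℕ → Submodule k H}

/-- The coproduct is compatible with the grading. -/
def IsGradedComul (ℋ : ℕ → Submodule k H) : Prop :=
  ∀ n : ℕ, ∀ x ∈ ℋ n,
    Coalgebra.comul (R := k) x ∈
      ⨆ (pq : ℕ × ℕ) (_ : pq.1 + pq.2 = n),
        LinearMap.range (TensorProduct.mapIncl (ℋ pq.1) (ℋ pq.2))

lemma IsGradedComul.ext (hΔ : IsGradedComul ℋ) {N : Type} [AddCommGroup N] [Module k N]
    {f g : H ⊗[k] H →ₗ[k] N} {n : ℕ}
    (h : ∀ a b, a + b = n → ∀ u ∈ ℋ a, ∀ v ∈ ℋ b, f (u ⊗ₜ v) = g (u ⊗ₜ v))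
    {x : H} (hx : x ∈ ℋ n) :
    f (Coalgebra.comul (R := k) x) = g (Coalgebra.comul (R := k) x) := by
  suffices hle : (⨆ (pq : ℕ × ℕ) (_ : pq.1 + pq.2 = n),
      LinearMap.range (TensorProduct.mapIncl (ℋ pq.1) (ℋ pq.2))) ≤ LinearMap.eqLocus f g from
    hle (hΔ n x hx)
  refine iSup₂_le fun pq hpq => ?_
  rintro _ ⟨t, rfl⟩
  rw [LinearMap.mem_eqLocus]
  induction t with
  | zero => simp
  | tmul u v => exact h _ _ hpq _ u.2 _ v.2
  | add s t hs ht => simp only [map_add, hs, ht]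

/-- Right convolution by a form vanishing in degree zero lowers degrees. -/
lemma IsGradedComul.rightConv_ext (hΔ : IsGradedComul ℋ) {A : H →ₗ[k] k}
    (hA : ∀ x ∈ ℋ 0, A x = 0) {N : Type} [AddCommGroup N] [Module k N] {f g : H →ₗ[k] N} {n : ℕ}
    (h : ∀ m < n, ∀ u ∈ ℋ m, f u = g u) {x : H} (hx : x ∈ ℋ n) :
    f (rightConv A x) = g (rightConv A x) := by
  refine hΔ.ext (f := f ∘ₗ (TensorProduct.rid k H).toLinearMap ∘ₗ A.lTensor H)
    (g := g ∘ₗ (TensorProduct.rid k H).toLinearMap ∘ₗ A.lTensor H) (fun a b hab u hu v hv => ?_) hx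
  rcases Nat.eq_zero_or_pos b with rfl | hb
  · simp [hA v hv]
  · simp [h a (by omega) u hu]

variable [DirectSum.Decomposition ℋ]

lemma gradedProj_of_mem {n : ℕ} {x : H} (hx : x ∈ ℋ n) : gradedProj ℋ n x = x :=
  DirectSum.decompose_of_mem_same ℋ hx

lemma gradedProj_of_mem_ne {m n : ℕ} {x : H} (hx : x ∈ ℋ m) (h : m ≠ n) :
    gradedProj ℋ n x = 0 :=
  DirectSum.decompose_of_mem_ne ℋ hx h

/-- Linear maps agreeing on all homogeneous elements are equal. -/
lemma ext_of_homogeneous (ℋ : ℕ → Submodule k H) [DirectSum.Decomposition ℋ]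
    {N : Type} [AddCommGroup N] [Module k N] {f g : H →ₗ[k] N}
    (h : ∀ n, ∀ x ∈ ℋ n, f x = g x) : f = g := by
  ext x
  induction x using DirectSum.Decomposition.inductionOn ℋ with
  | zero => simp
  | homogeneous x => exact h _ x x.2
  | add x y hx hy => rw [map_add, map_add, hx, hy]

/-- In a connected graded bialgebra the counit vanishes in positive degree. -/
lemma IsGradedComul.counit_eq_zero (hΔ : IsGradedComul ℋ) {n : ℕ} (hn : 0 < n) {x : H}
    (hx : x ∈ ℋ n) : Coalgebra.counit (R := k) x = 0 := by
  set e : H →ₗ[k] k := Coalgebra.counit (R := k) ∘ₗ gradedProj ℋ 0 with he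
  have h : gradedProj ℋ n (rightConv (Coalgebra.counit (R := k)) x) = rightConv e x := by
    refine hΔ.ext (f := gradedProj ℋ n ∘ₗ (TensorProduct.rid k H).toLinearMap ∘ₗ
      (Coalgebra.counit (R := k)).lTensor H)
      (g := (TensorProduct.rid k H).toLinearMap ∘ₗ e.lTensor H) (fun a b hab u hu v hv => ?_) hx
    rcases Nat.eq_zero_or_pos b with rfl | hb
    · obtain rfl : a = n := by omega
      simp [he, gradedProj_of_mem hu, gradedProj_of_mem hv]
    · simp [he, gradedProj_of_mem_ne hu (show a ≠ n by omega), gradedProj_of_mem_ne hv hb.ne']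
  rw [rightConv_counit, gradedProj_of_mem hx] at h
  rw [h, ← LinearMap.comp_apply, ← convK_eq_comp_rightConv, counit_convK, he,
    LinearMap.comp_apply, gradedProj_of_mem_ne hx hn.ne', map_zero]

variable {Y : H →ₗ[k] H}

/-- The grading operator is a derivation. -/
lemma grading_mul (hmul : ∀ p q : ℕ, ∀ x ∈ ℋ p, ∀ y ∈ ℋ q, x * y ∈ ℋ (p + q))
    (hY : ∀ n : ℕ, ∀ x ∈ ℋ n, Y x = (n : k) • x) (x y : H) :
    Y (x * y) = Y x * y + x * Y y := by
  have h : (LinearMap.mul k H).compr₂ Y =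
      (LinearMap.mul k H) ∘ₗ Y + (LinearMap.mul k H).compl₂ Y := by
    refine ext_of_homogeneous ℋ fun p x hx => ext_of_homogeneous ℋ fun q y hy => ?_
    simp [hY _ _ (hmul p q x hx y hy), hY p x hx, hY q y hy, add_smul]
  exact LinearMap.congr_fun₂ h x y

/-- The functional `Q_n(α)`. -/
def QForm (ℋ : ℕ → Submodule k H) [DirectSum.Decomposition ℋ] (α : H →ₗ[k] k) (n : ℕ) :
    H →ₗ[k] k :=
  ∑ c : Composition n,
    kappa k c.blocks • convList (c.blocks.map (fun j => α ∘ₗ gradedProj ℋ j))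

lemma QForm_apply (α : H →ₗ[k] k) (n : ℕ) (x : H) : QForm ℋ α n x = QFormula ℋ α n x := by
  simp [QForm, QFormula]

lemma QForm_zero (α : H →ₗ[k] k) : QForm ℋ α 0 = Coalgebra.counit (R := k) := by
  have h (c : Composition 0) : c.blocks = [] := by simp
  have : Subsingleton (Composition 0) := ⟨fun c d => Composition.ext ((h c).trans (h d).symm)⟩
  rw [QForm, Fintype.sum_subsingleton _ (Composition.ones 0)]
  simp [kappa, partialSumsProd, convList]

variable [CharZero k]

/-- The equation `F ∘ Y = F * A` determines `F` from its degree zero part. -/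
lemma IsGradedComul.eq_of_comp_grading (hΔ : IsGradedComul ℋ)
    (hY : ∀ n : ℕ, ∀ x ∈ ℋ n, Y x = (n : k) • x) {A : H →ₗ[k] k} (hA : ∀ x ∈ ℋ 0, A x = 0)
    {F G : H →ₗ[k] k} (hF : F ∘ₗ Y = convK F A) (hG : G ∘ₗ Y = convK G A)
    (h0 : ∀ x ∈ ℋ 0, F x = G x) : F = G := by
  refine ext_of_homogeneous ℋ fun n => ?_
  induction n using Nat.strong_induction_on with
  | _ n ih =>
    intro x hx
    rcases Nat.eq_zero_or_pos n with rfl | hn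
    · exact h0 x hx
    · have hn' : (n : k) ≠ 0 := Nat.cast_ne_zero.2 hn.ne'
      refine mul_left_cancel₀ hn' ?_
      rw [convK_eq_comp_rightConv] at hF hG
      have h1 := LinearMap.congr_fun hF x
      have h2 := LinearMap.congr_fun hG x
      simp only [LinearMap.comp_apply, hY n x hx, map_smul, smul_eq_mul] at h1 h2
      rw [h1, h2]
      exact hΔ.rightConv_ext hA ih hx

/-- A solution of `G ∘ Y = G * A` with `A` an infinitesimal character is multiplicative. -/
lemma IsGradedComul.isChar_of_comp_grading (hΔ : IsGradedComul ℋ)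
    (hmul : ∀ p q : ℕ, ∀ x ∈ ℋ p, ∀ y ∈ ℋ q, x * y ∈ ℋ (p + q))
    (hconn : ℋ 0 = Submodule.span k {(1 : H)})
    (hY : ∀ n : ℕ, ∀ x ∈ ℋ n, Y x = (n : k) • x) {A : H →ₗ[k] k} (hA : IsInfChar A)
    {G : H →ₗ[k] k} (hG : G ∘ₗ Y = convK G A) (h1 : G 1 = 1) : IsChar G := by
  have hA0 : ∀ x ∈ ℋ 0, A x = 0 := by
    intro x hx
    rw [hconn] at hx
    obtain ⟨c, rfl⟩ := Submodule.mem_span_singleton.1 hx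
    simp [hA.map_one]
  rw [convK_eq_comp_rightConv] at hG
  have hG' {n : ℕ} {x : H} (hx : x ∈ ℋ n) : G (rightConv A x) = n * G x := by
    simpa [hY n x hx] using (LinearMap.congr_fun hG x).symm
  have main : ∀ n p q : ℕ, p + q = n → ∀ x ∈ ℋ p, ∀ y ∈ ℋ q, G (x * y) = G x * G y := by
    intro n
    induction n using Nat.strong_induction_on with
    | _ n ih =>
      intro p q hpq x hx y hy
      rcases Nat.eq_zero_or_pos n with rfl | hn
      · obtain ⟨rfl, rfl⟩ : p = 0 ∧ q = 0 := by omega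
        rw [hconn] at hx hy
        obtain ⟨c, rfl⟩ := Submodule.mem_span_singleton.1 hx
        obtain ⟨d, rfl⟩ := Submodule.mem_span_singleton.1 hy
        simp [h1, mul_comm]
      · have e1 : G (rightConv A x * y) = G (rightConv A x) * G y :=
          hΔ.rightConv_ext (f := G ∘ₗ LinearMap.mulRight k y) (g := (LinearMap.mulRight k (G y)) ∘ₗ G)
            hA0 (fun m hm u hu => ih (m + q) (by omega) m q rfl u hu y hy) hx
        have e2 : G (x * rightConv A y) = G x * G (rightConv A y) :=
          hΔ.rightConv_ext (f := G ∘ₗ LinearMap.mulLeft k x) (g := (LinearMap.mulLeft k (G x)) ∘ₗ G)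
            hA0 (fun m hm u hu => ih (p + m) (by omega) p m rfl x hx u hu) hy
        have e3 := hG' (hmul p q x hx y hy)
        rw [hA.rightConv_mul, map_add, e1, e2, hG' hx, hG' hy] at e3
        have hn' : ((p + q : ℕ) : k) ≠ 0 := Nat.cast_ne_zero.2 (by omega)
        refine mul_left_cancel₀ hn' ?_
        rw [← e3]
        push_cast
        ring
  refine ⟨h1, fun x y => ?_⟩
  have h : (LinearMap.mul k H).compr₂ G = (LinearMap.mul k k).compl₁₂ G G :=
    ext_of_homogeneous ℋ fun p x hx => ext_of_homogeneous ℋ fun q y hy =>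
      main _ p q rfl x hx y hy
  exact LinearMap.congr_fun₂ h x y

lemma natCast_smul_QForm (α : H →ₗ[k] k) {n : ℕ} (hn : 0 < n) :
    (n : k) • QForm ℋ α n = ∑ j ∈ Finset.range n,
      ((j + 1 : ℕ) : k) • convK (QForm ℋ α (n - 1 - j)) (α ∘ₗ gradedProj ℋ (j + 1)) := by
  have hn' : (n : k) ≠ 0 := Nat.cast_ne_zero.2 hn.ne'
  rw [QForm, Composition.sum_eq_sum_last hn (fun l =>
    kappa k l • convList (l.map (fun j => α ∘ₗ gradedProj ℋ j))), Finset.smul_sum]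
  refine Finset.sum_congr rfl fun j hj => ?_
  rw [Finset.mem_range] at hj
  have hsum : QForm ℋ α (n - 1 - j) ∘ₗ rightConv (α ∘ₗ gradedProj ℋ (j + 1)) =
      ∑ c : Composition (n - 1 - j), (kappa k c.blocks •
        convList (c.blocks.map fun j => α ∘ₗ gradedProj ℋ j)) ∘ₗ
          rightConv (α ∘ₗ gradedProj ℋ (j + 1)) := by
    ext x
    simp [QForm]
  rw [convK_eq_comp_rightConv, hsum, Finset.smul_sum, Finset.smul_sum]
  refine Finset.sum_congr rfl fun c _ => ?_
  rw [kappa_append_singleton, c.blocks_sum, List.map_append, List.map_singleton,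
    convList_append_singleton, convK_eq_comp_rightConv, LinearMap.smul_comp, smul_smul, smul_smul,
    show n - 1 - j + (j + 1) = n by omega]
  congr 1
  field_simp

/-- `Q(α)` solves `G ∘ Y = G * (α ∘ Y)`. -/
lemma IsGradedComul.Q_comp_grading (hΔ : IsGradedComul ℋ)
    (hY : ∀ n : ℕ, ∀ x ∈ ℋ n, Y x = (n : k) • x) {α G : H →ₗ[k] k}
    (hG : ∀ n : ℕ, ∀ x ∈ ℋ n, G x = QFormula ℋ α n x) :
    G ∘ₗ Y = convK G (α ∘ₗ Y) := by
  simp only [← QForm_apply] at hG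
  refine ext_of_homogeneous ℋ fun n x hx => ?_
  have hL : (G ∘ₗ Y) x = ∑ j ∈ Finset.range n, ((j + 1 : ℕ) : k) •
      convK (QForm ℋ α (n - 1 - j)) (α ∘ₗ gradedProj ℋ (j + 1)) x := by
    rcases Nat.eq_zero_or_pos n with rfl | hn
    · simp [hY 0 x hx]
    · have h := LinearMap.congr_fun (natCast_smul_QForm (ℋ := ℋ) α hn) x
      simpa [hY n x hx, hG n x hx] using h
  rw [hL]
  have h := hΔ.ext (f := ∑ j ∈ Finset.range n, ((j + 1 : ℕ) : k) • LinearMap.mul' k k ∘ₗ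
      TensorProduct.map (QForm ℋ α (n - 1 - j)) (α ∘ₗ gradedProj ℋ (j + 1)))
    (g := LinearMap.mul' k k ∘ₗ TensorProduct.map G (α ∘ₗ Y)) (fun a b hab u hu v hv => ?_) hx
  · simpa [convK_apply] using h
  · simp only [LinearMap.sum_apply, LinearMap.smul_apply, LinearMap.comp_apply,
      TensorProduct.map_tmul, LinearMap.mul'_apply, hG a u hu, hY b v hv, map_smul, smul_eq_mul]
    rcases b with _ | b
    · rw [Finset.sum_eq_zero fun j _ => by rw [gradedProj_of_mem_ne hv (by omega)]; simp]
      simp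
    · rw [Finset.sum_eq_single_of_mem b (Finset.mem_range.2 (by omega)) fun j _ hj => by
        rw [gradedProj_of_mem_ne hv (by omega)]; simp]
      rw [gradedProj_of_mem hv, show n - 1 - b = a by omega]
      ring

end Graded

/-- Let `H` be a graded, commutative, connected Hopf algebra over a field
`k` of characteristic zero.  Then `Q` is a bijection from the infinitesimal characters
`g(H)` onto the characters `G(H)`, with inverse `β ↦ β ∘ Y⁻¹ ∘ D`, right composition with
the Dynkin idempotent (where `D = S * Y` and `Y⁻¹ ∘ D` acts on `H_n` as `(1/n)·D` for
`n ≥ 1` and as `0` on `H_0`). -/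
theorem Q_bijection_with_dynkin_idempotent_inverse
    {k H : Type} [Field k] [CharZero k] [CommRing H] [HopfAlgebra k H]
    (ℋ : ℕ → Submodule k H) [DirectSum.Decomposition ℋ]
    (hmul : ∀ p q : ℕ, ∀ x ∈ ℋ p, ∀ y ∈ ℋ q, x * y ∈ ℋ (p + q))
    (hcomul : ∀ n : ℕ, ∀ x ∈ ℋ n,
      Coalgebra.comul (R := k) x ∈
        ⨆ (pq : ℕ × ℕ) (_ : pq.1 + pq.2 = n),
          LinearMap.range (TensorProduct.mapIncl (ℋ pq.1) (ℋ pq.2)))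
    (hconn : ℋ 0 = Submodule.span k {(1 : H)})
    -- the grading operator `Y` and the Dynkin operator `D = S * Y`
    (Y : H →ₗ[k] H) (hY : ∀ n : ℕ, ∀ x ∈ ℋ n, Y x = (n : k) • x)
    (D : H →ₗ[k] H) (hD : D = convE (HopfAlgebra.antipode (R := k)) Y)
    -- the Dynkin idempotent `M = Y⁻¹ ∘ D`
    (M : H →ₗ[k] H)
    (hM0 : ∀ x ∈ ℋ 0, M x = 0)
    (hMn : ∀ n : ℕ, 0 < n → ∀ x ∈ ℋ n, M x = ((n : k))⁻¹ • D x) :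
    -- `Q` maps `g(H)` to `G(H)` and `- ∘ (Y⁻¹ ∘ D)` recovers the argument
    (∀ α G : H →ₗ[k] k, IsInfChar α →
      (∀ n : ℕ, ∀ x ∈ ℋ n, G x = QFormula ℋ α n x) →
      IsChar G ∧ G ∘ₗ M = α) ∧
    -- `- ∘ (Y⁻¹ ∘ D)` maps `G(H)` to `g(H)` and `Q` recovers the argument
    (∀ β : H →ₗ[k] k, IsChar β →
      IsInfChar (β ∘ₗ M) ∧
      (∀ G : H →ₗ[k] k,
        (∀ n : ℕ, ∀ x ∈ ℋ n, G x = QFormula ℋ (β ∘ₗ M) n x) → G = β)) := by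
  have hΔ : IsGradedComul ℋ := hcomul
  have h1mem : (1 : H) ∈ ℋ 0 := hconn ▸ Submodule.mem_span_singleton_self 1
  have hdeg0 {f g : H →ₗ[k] k} (h : f 1 = g 1) : ∀ x ∈ ℋ 0, f x = g x := by
    intro x hx
    rw [hconn] at hx
    obtain ⟨c, rfl⟩ := Submodule.mem_span_singleton.1 hx
    rw [map_smul, map_smul, h]
  have hYmul := grading_mul hmul hY
  have hY0 : ∀ x ∈ ℋ 0, Y x = 0 := fun x hx => by simp [hY 0 x hx]
  have hεY (x : H) : Coalgebra.counit (R := k) (Y x) = 0 := by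
    suffices h : Coalgebra.counit (R := k) ∘ₗ Y = 0 from LinearMap.congr_fun h x
    refine ext_of_homogeneous ℋ fun n x hx => ?_
    rcases Nat.eq_zero_or_pos n with rfl | hn
    · simp [hY0 x hx]
    · simp [hY n x hx, hΔ.counit_eq_zero hn hx]
  have hQone {α G : H →ₗ[k] k} (hG : ∀ n : ℕ, ∀ x ∈ ℋ n, G x = QFormula ℋ α n x) : G 1 = 1 := by
    rw [hG 0 1 h1mem, ← QForm_apply, QForm_zero, Bialgebra.counit_one]
  constructor
  · intro α G hα hG
    have hA : IsInfChar (α ∘ₗ Y) := fun x y => by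
      simp only [LinearMap.comp_apply, hYmul, map_add, hα (Y x) y, hα x (Y y), hεY]
      ring
    have hGY := hΔ.Q_comp_grading hY hG
    have hchar := hΔ.isChar_of_comp_grading hmul hconn hY hA hGY (hQone hG)
    refine ⟨hchar, ext_of_homogeneous ℋ fun n x hx => ?_⟩
    rcases Nat.eq_zero_or_pos n with rfl | hn
    · rw [LinearMap.comp_apply, hM0 x hx, map_zero]
      exact (hdeg0 (f := α) (g := 0) hα.map_one x hx).symm
    · have hn' : (n : k) ≠ 0 := Nat.cast_ne_zero.2 hn.ne'
      have hGD := LinearMap.congr_fun ((hchar.comp_dynkin_eq_iff Y _).2 hGY) x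
      rw [← hD] at hGD
      simp only [LinearMap.comp_apply, hY n x hx, map_smul, smul_eq_mul] at hGD
      rw [LinearMap.comp_apply, hMn n hn x hx, map_smul, hGD, smul_eq_mul,
        inv_mul_cancel_left₀ hn']
  · intro β hβ
    have hα1 : (β ∘ₗ M) 1 = 0 := by simp [hM0 1 h1mem]
    have hDmul (x y : H) : D (x * y) =
        Coalgebra.counit (R := k) y • D x + Coalgebra.counit (R := k) x • D y := by
      rw [hD]
      exact convE_antipode_mul hYmul x y
    have hD1 : D 1 = 0 := by simpa using hDmul 1 1
    have hMD : β ∘ₗ D = (β ∘ₗ M) ∘ₗ Y := by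
      refine ext_of_homogeneous ℋ fun n x hx => ?_
      rcases Nat.eq_zero_or_pos n with rfl | hn
      · rw [LinearMap.comp_apply ((β ∘ₗ M)), hY0 x hx, map_zero]
        exact hdeg0 (f := β ∘ₗ D) (g := 0) (by simp [hD1]) x hx
      · have hn' : (n : k) ≠ 0 := Nat.cast_ne_zero.2 hn.ne'
        simp [hY n x hx, hMn n hn x hx, hn']
    refine ⟨fun x y => ?_, fun G hG => ?_⟩
    · suffices h : (LinearMap.mul k H).compr₂ (β ∘ₗ M) =
          (LinearMap.mul k k).compl₁₂ (β ∘ₗ M) (Coalgebra.counit (R := k)) +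
            (LinearMap.mul k k).compl₁₂ (Coalgebra.counit (R := k)) (β ∘ₗ M) from
        LinearMap.congr_fun₂ h x y
      refine ext_of_homogeneous ℋ fun p x hx => ext_of_homogeneous ℋ fun q y hy => ?_
      change (β ∘ₗ M) (x * y) = (β ∘ₗ M) x * Coalgebra.counit (R := k) y +
        Coalgebra.counit (R := k) x * (β ∘ₗ M) y
      rcases Nat.eq_zero_or_pos p with rfl | hp
      · rw [hconn] at hx
        obtain ⟨c, rfl⟩ := Submodule.mem_span_singleton.1 hx
        rw [smul_one_mul, map_smul, map_smul, hα1, map_smul, Bialgebra.counit_one]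
        simp
      rcases Nat.eq_zero_or_pos q with rfl | hq
      · rw [hconn] at hy
        obtain ⟨c, rfl⟩ := Submodule.mem_span_singleton.1 hy
        rw [mul_smul_one, map_smul, map_smul, map_smul, hα1, Bialgebra.counit_one]
        simp [mul_comm]
      rw [LinearMap.comp_apply, hMn (p + q) (by omega) _ (hmul p q x hx y hy), hDmul,
        hΔ.counit_eq_zero hp hx, hΔ.counit_eq_zero hq hy]
      simp
    · rw [hD] at hMD
      refine hΔ.eq_of_comp_grading hY (A := (β ∘ₗ M) ∘ₗ Y) (fun x hx => ?_)
        (hΔ.Q_comp_grading hY hG) ((hβ.comp_dynkin_eq_iff Y _).1 hMD)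
        (hdeg0 (by rw [hQone hG, hβ.1]))
      rw [LinearMap.comp_apply, hY0 x hx, map_zero]

end
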